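/- Let β ∈ ℝ, 0 < α < 8/(d+n), E and m_c as above, and assume m_{c₁} < 0 and that some minimizing sequence (u_n) for m_{c₁} satisfies liminf ‖u_n‖_{α+2} > 0. Then for all 0 < c₁ < c₂ the strict inequality m_{c₂} < (c₂/c₁) m_{c₁} holds. -/

import Mathlib

noncomputable section

open MeasureTheory Real Filter Set

namespace BNLS

/-- A point of `ℝ^d × 𝕋^n`, the torus being modelled by periodic functions on `ℝ^n`. -/
abbrev Pt (d n : ℕ) := (Fin d → ℝ) × (Fin n → ℝ)

/-- Fundamental domain `[0,2π)^n` of the torus `(ℝ/2πℤ)^n`. -/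
def torusBox (n : ℕ) : Set (Fin n → ℝ) := Set.univ.pi fun _ => Set.Ico 0 (2*π)

/-- The measure of the torus `𝕋^n`. -/
def μT (n : ℕ) : Measure (Fin n → ℝ) := volume.restrict (torusBox n)

/-- The measure of `ℝ^d × 𝕋^n`. -/
def μP (d n : ℕ) : Measure (Pt d n) := (volume : Measure (Fin d → ℝ)).prod (μT n)

/-- Partial derivative in the `i`-th `x`-direction. -/
def dX (d n : ℕ) (i : Fin d) (u : Pt d n → ℂ) : Pt d n → ℂ :=
  fun p => fderiv ℝ u p (Pi.single i 1, 0)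

/-- Partial derivative in the `j`-th `y`-direction. -/
def dY (d n : ℕ) (j : Fin n) (u : Pt d n → ℂ) : Pt d n → ℂ :=
  fun p => fderiv ℝ u p (0, Pi.single j 1)

/-- Partial Laplacian `Δ_x`. -/
def lapX (d n : ℕ) (u : Pt d n → ℂ) : Pt d n → ℂ := fun p => ∑ i, dX d n i (dX d n i u) p

/-- Partial Laplacian `Δ_y`. -/
def lapY (d n : ℕ) (u : Pt d n → ℂ) : Pt d n → ℂ := fun p => ∑ j, dY d n j (dY d n j u) p

/-- Full Laplacian `Δ_{x,y}`. -/
def lap (d n : ℕ) (u : Pt d n → ℂ) : Pt d n → ℂ := fun p => lapX d n u p + lapY d n u p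

/-- Mass `‖u‖_{L²}²`. -/
def Mass (d n : ℕ) (u : Pt d n → ℂ) : ℝ := ∫ z, ‖u z‖^2 ∂(μP d n)

/-- `‖u‖_{L^p}^p`. -/
def Npow (d n : ℕ) (p : ℝ) (u : Pt d n → ℂ) : ℝ := ∫ z, ‖u z‖ ^ p ∂(μP d n)

/-- The `L^p` norm. -/
def LpN (d n : ℕ) (p : ℝ) (u : Pt d n → ℂ) : ℝ := (Npow d n p u) ^ (1/p)

/-- `‖Δ u‖_{L²}²`. -/
def lapSq (d n : ℕ) (u : Pt d n → ℂ) : ℝ := ∫ z, ‖lap d n u z‖^2 ∂(μP d n)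

/-- `‖Δ_x u‖_{L²}²`. -/
def lapXSq (d n : ℕ) (u : Pt d n → ℂ) : ℝ := ∫ z, ‖lapX d n u z‖^2 ∂(μP d n)

/-- `‖Δ_y u‖_{L²}²`. -/
def lapYSq (d n : ℕ) (u : Pt d n → ℂ) : ℝ := ∫ z, ‖lapY d n u z‖^2 ∂(μP d n)

/-- `‖∇_x u‖_{L²}²`. -/
def gradXSq (d n : ℕ) (u : Pt d n → ℂ) : ℝ := ∫ z, (∑ i, ‖dX d n i u z‖^2) ∂(μP d n)

/-- `‖∇_y u‖_{L²}²`. -/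
def gradYSq (d n : ℕ) (u : Pt d n → ℂ) : ℝ := ∫ z, (∑ j, ‖dY d n j u z‖^2) ∂(μP d n)

/-- `‖∇ u‖_{L²}²`. -/
def gradSq (d n : ℕ) (u : Pt d n → ℂ) : ℝ := gradXSq d n u + gradYSq d n u

/-- Pointwise sum of squares of all second derivatives. -/
def hessInt (d n : ℕ) (u : Pt d n → ℂ) (z : Pt d n) : ℝ :=
  (∑ i, ∑ i', ‖dX d n i (dX d n i' u) z‖^2) + (∑ i, ∑ j, ‖dY d n j (dX d n i u) z‖^2)
  + (∑ j, ∑ i, ‖dX d n i (dY d n j u) z‖^2) + (∑ j, ∑ j', ‖dY d n j (dY d n j' u) z‖^2)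

/-- `‖∇² u‖_{L²}²`. -/
def hessSq (d n : ℕ) (u : Pt d n → ℂ) : ℝ := ∫ z, hessInt d n u z ∂(μP d n)

/-- The `H²` norm on `ℝ^d × 𝕋^n`. -/
def H2norm (d n : ℕ) (u : Pt d n → ℂ) : ℝ :=
  Real.sqrt (Mass d n u + gradSq d n u + hessSq d n u)

/-- `2π`-periodicity in all `y`-variables. -/
def Periodic (d n : ℕ) (u : Pt d n → ℂ) : Prop :=
  ∀ j : Fin n, ∀ p : Pt d n, u (p.1, p.2 + (2*π) • (Pi.single j 1 : Fin n → ℝ)) = u p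

/-- Membership in `H²(ℝ^d × 𝕋^n)`. -/
def InH2 (d n : ℕ) (u : Pt d n → ℂ) : Prop :=
  ContDiff ℝ 2 u ∧ Periodic d n u ∧
  Integrable (fun z => ‖u z‖^2) (μP d n) ∧
  Integrable (fun z => (∑ i, ‖dX d n i u z‖^2) + ∑ j, ‖dY d n j u z‖^2) (μP d n) ∧
  Integrable (hessInt d n u) (μP d n)

/-- The mass sphere `S(c)`. -/
def Sset (d n : ℕ) (c : ℝ) : Set (Pt d n → ℂ) := {u | InH2 d n u ∧ Mass d n u = c}

/-- The energy functional `E`. -/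
def En (d n : ℕ) (β α : ℝ) (u : Pt d n → ℂ) : ℝ :=
  (1/2) * lapSq d n u + (β/2) * gradSq d n u - (1/(α+2)) * Npow d n (α+2) u

/-- The ground state energy `m_c`. -/
def mC (d n : ℕ) (β α c : ℝ) : ℝ := sInf (En d n β α '' Sset d n c)

end BNLS

namespace BNLS

open scoped ENNReal Pointwise

/-- Periodicity for functions with values in an arbitrary type. -/
def Per {γ : Type*} (d n : ℕ) (f : Pt d n → γ) : Prop :=
  ∀ j : Fin n, ∀ p : Pt d n, f (p.1, p.2 + (2*π) • (Pi.single j 1 : Fin n → ℝ)) = f p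

lemma two_pi_ne : (2 * π : ℝ) ≠ 0 := by positivity

/-- The lattice basis of the torus. -/
def tB (n : ℕ) : Module.Basis (Fin n) ℝ (Fin n → ℝ) :=
  (Pi.basisFun ℝ (Fin n)).unitsSMul (fun _ => Units.mk0 (2*π) two_pi_ne)

lemma tB_apply (n : ℕ) (j : Fin n) : tB n j = (2*π) • (Pi.single j 1 : Fin n → ℝ) := by
  simp [tB, Module.Basis.unitsSMul_apply, Units.smul_def]

lemma fd_eq (n : ℕ) : ZSpan.fundamentalDomain (tB n) = torusBox n := by
  ext y
  have hp : (0:ℝ) < 2 * π := by positivity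
  simp only [ZSpan.mem_fundamentalDomain, torusBox, Set.mem_univ_pi, tB,
    Module.Basis.repr_unitsSMul, Pi.basisFun_repr, Units.smul_def, smul_eq_mul]
  refine forall_congr' fun i => ?_
  simp only [Set.mem_Ico, Units.val_inv_eq_inv_val, Units.val_mk0]
  rw [inv_mul_eq_div, le_div_iff₀ hp, div_lt_iff₀ hp]
  simp

lemma lint_shift_T (n : ℕ) (g : (Fin n → ℝ) → ℝ≥0∞)
    (hg : ∀ j y, g (y + (2*π) • (Pi.single j 1 : Fin n → ℝ)) = g y) (w : Fin n → ℝ) :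
    ∫⁻ y, g (y + w) ∂(μT n) = ∫⁻ y, g y ∂(μT n) := by
  have h1 : IsAddFundamentalDomain (Submodule.span ℤ (Set.range (tB n))).toAddSubgroup
      (torusBox n) (volume : Measure (Fin n → ℝ)) := by
    rw [← fd_eq]; exact ZSpan.isAddFundamentalDomain' (tB n) volume
  have h2 := h1.vadd_of_comm w
  have hinv : ∀ (l : (Submodule.span ℤ (Set.range (tB n))).toAddSubgroup) (x : Fin n → ℝ),
      g (l +ᵥ x) = g x := by
    rintro ⟨l, hl⟩ x
    change g (l + x) = g x
    have hl' : l ∈ Submodule.span ℤ (Set.range (tB n)) := hl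
    clear hl
    induction hl' using Submodule.span_induction generalizing x with
    | mem l hl =>
      obtain ⟨j, rfl⟩ := hl
      rw [add_comm, tB_apply, hg]
    | zero => simp
    | add a b _ _ ha hb => rw [add_assoc, ha, hb]
    | smul k a _ ha =>
      induction k using Int.induction_on generalizing x with
      | zero => simp
      | succ m ih => rw [add_smul, one_smul, add_assoc, ih, ha]
      | pred m ih =>
        rw [sub_smul, one_smul, sub_add_eq_add_sub, add_sub_assoc, ih, ← ha (x - a)]
        congr 1; abel
  haveI : Countable (Submodule.span ℤ (Set.range (tB n))).toAddSubgroup :=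
    inferInstanceAs (Countable (Submodule.span ℤ (Set.range (tB n))))
  have h3 := h1.setLIntegral_eq h2 g hinv
  unfold μT
  rw [h3]
  have hmp : MeasurePreserving (fun y : Fin n → ℝ => y + w) volume volume :=
    measurePreserving_add_right _ w
  have hemb : MeasurableEmbedding (fun y : Fin n → ℝ => y + w) :=
    measurableEmbedding_addRight w
  have := hmp.setLIntegral_comp_preimage_emb hemb g (w +ᵥ torusBox n)
  rw [← this]
  congr 2
  ext y
  simp [Set.mem_vadd_set_iff_neg_vadd_mem]

instance (n : ℕ) : SFinite (μT n) := by unfold μT; infer_instance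
instance (d n : ℕ) : SFinite (μP d n) := by unfold μP; infer_instance

lemma lint_shift (d n : ℕ) (g : Pt d n → ℝ≥0∞) (hm : Measurable g) (hg : Per d n g)
    (w : Pt d n) : ∫⁻ z, g (z + w) ∂(μP d n) = ∫⁻ z, g z ∂(μP d n) := by
  unfold μP
  rw [lintegral_prod _ (by fun_prop), lintegral_prod _ (by fun_prop)]
  have : ∀ x : Fin d → ℝ, ∫⁻ y, g ((x, y) + w) ∂(μT n) = ∫⁻ y, g (x + w.1, y) ∂(μT n) := by
    intro x
    exact lint_shift_T n (fun y => g (x + w.1, y)) (fun j y => hg j (x + w.1, y)) w.2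
  simp only [this]
  exact lintegral_add_right_eq_self (fun x => ∫⁻ y, g (x, y) ∂(μT n)) w.1

lemma Per.shift {γ : Type*} {d n : ℕ} {f : Pt d n → γ} (hf : Per d n f) (w : Pt d n) :
    Per d n (fun z => f (z + w)) := by
  intro j p
  have := hf j (p + w)
  refine Eq.trans ?_ this
  show f _ = f _
  congr 1
  ext <;> simp [add_right_comm]

lemma Per.comp {γ δ : Type*} {d n : ℕ} {f : Pt d n → γ} (hf : Per d n f) (g : γ → δ) :
    Per d n (fun z => g (f z)) := fun j p => by simp only [hf j p]

lemma int_shift {d n : ℕ} {f : Pt d n → ℝ} (hc : Continuous f) (hf : Per d n f)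
    (hi : Integrable f (μP d n)) (w : Pt d n) :
    Integrable (fun z => f (z + w)) (μP d n) ∧
      ∫ z, f (z + w) ∂(μP d n) = ∫ z, f z ∂(μP d n) := by
  have hi' : Integrable (fun z => f (z + w)) (μP d n) := by
    refine ⟨(by fun_prop : Continuous fun z => f (z + w)).aestronglyMeasurable, ?_⟩
    have := lint_shift d n (fun z => ‖f z‖ₑ) (by fun_prop) (hf.comp _) w
    have h2 := hi.2
    unfold HasFiniteIntegral at h2 ⊢
    rw [this]; exact h2
  refine ⟨hi', ?_⟩
  rw [integral_eq_lintegral_pos_part_sub_lintegral_neg_part hi',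
    integral_eq_lintegral_pos_part_sub_lintegral_neg_part hi,
    lint_shift d n (fun z => ENNReal.ofReal (f z)) (by fun_prop) (hf.comp _) w,
    lint_shift d n (fun z => ENNReal.ofReal (-f z)) (by fun_prop) (hf.comp (fun t => ENNReal.ofReal (-t))) w]

/-- averaging a function along a segment does not change the integral -/
lemma int_avg {d n : ℕ} {f : Pt d n → ℝ} (hc : Continuous f) (hf : Per d n f)
    (hi : Integrable f (μP d n)) (w : Pt d n) :
    Integrable (fun z => ∫ s in (0:ℝ)..1, f (z + s • w)) (μP d n) ∧
      ∫ z, (∫ s in (0:ℝ)..1, f (z + s • w)) ∂(μP d n) = ∫ z, f z ∂(μP d n) := by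
  have hI : Integrable (Function.uncurry fun (z : Pt d n) (s : ℝ) => f (z + s • w))
      ((μP d n).prod (volume.restrict (Set.Ioc (0:ℝ) 1))) := by
    rw [integrable_prod_iff']
    · refine ⟨ae_of_all _ fun s => (int_shift hc hf hi (s • w)).1, ?_⟩
      have : ∀ s : ℝ, ∫ z, ‖f (z + s • w)‖ ∂(μP d n) = ∫ z, ‖f z‖ ∂(μP d n) := fun s =>
        (int_shift (f := fun z => ‖f z‖) (by fun_prop) (hf.comp _) hi.norm (s • w)).2
      simp only [Function.uncurry, this]
      exact integrable_const _
    · exact (by fun_prop : Continuous (Function.uncurry fun (z : Pt d n) (s : ℝ) =>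
        f (z + s • w))).aestronglyMeasurable
  simp only [intervalIntegral.integral_of_le zero_le_one]
  refine ⟨hI.integral_prod_left, ?_⟩
  rw [integral_integral_swap hI]
  have : ∀ s : ℝ, ∫ z, f (z + s • w) ∂(μP d n) = ∫ z, f z ∂(μP d n) := fun s =>
        (int_shift hc hf hi (s • w)).2
  simp [this]

end BNLS

namespace BNLS

open scoped ENNReal Pointwise InnerProductSpace

/-- Coordinate directions. -/
def eb (d n : ℕ) : Fin d ⊕ Fin n → Pt d n
  | Sum.inl i => (Pi.single i 1, 0)
  | Sum.inr j => (0, Pi.single j 1)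

/-- Coordinates. -/
def co {d n : ℕ} (w : Pt d n) : Fin d ⊕ Fin n → ℝ := Sum.elim w.1 w.2

/-- Partial derivative. -/
def pd {d n : ℕ} (i : Fin d ⊕ Fin n) (u : Pt d n → ℂ) : Pt d n → ℂ :=
  fun p => fderiv ℝ u p (eb d n i)

/-- Squared length of the gradient. -/
def Gs {d n : ℕ} (u : Pt d n → ℂ) : Pt d n → ℝ := fun p => ∑ i, ‖pd i u p‖ ^ 2

lemma lap_eq {d n : ℕ} (u : Pt d n → ℂ) : lap d n u = fun p => ∑ i, pd i (pd i u) p := by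
  funext p
  rw [Fintype.sum_sum_type]; rfl

lemma sum_co {d n : ℕ} (w : Pt d n) : ∑ i, co w i • eb d n i = w := by
  rw [Fintype.sum_sum_type]
  ext k
  · simp [co, eb, Prod.fst_sum, Pi.single_apply]
  · simp [co, eb, Prod.snd_sum, Pi.single_apply]

lemma fderiv_bound {d n : ℕ} (v : Pt d n → ℂ) (z w : Pt d n) :
    ‖fderiv ℝ v z w‖ ^ 2 ≤ (∑ i, co w i ^ 2) * Gs v z := by
  have h : fderiv ℝ v z w = ∑ i, co w i • pd i v z := by
    conv_lhs => rw [← sum_co w]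
    simp [pd]
  rw [h]
  calc ‖∑ i, co w i • pd i v z‖ ^ 2 ≤ (∑ i, |co w i| * ‖pd i v z‖) ^ 2 := by
        gcongr
        refine (norm_sum_le _ _).trans (le_of_eq ?_)
        simp
    _ ≤ (∑ i, |co w i| ^ 2) * ∑ i, ‖pd i v z‖ ^ 2 := Finset.sum_mul_sq_le_sq_mul_sq _ _ _
    _ = _ := by simp [Gs]

lemma Per.fderiv {d n : ℕ} {u : Pt d n → ℂ} (hu : Per d n u) : Per d n (fderiv ℝ u) := by
  intro j p
  have h : (fun z : Pt d n => u (z + (0, (2*π) • (Pi.single j 1 : Fin n → ℝ)))) = u := by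
    funext z
    refine Eq.trans ?_ (hu j z)
    congr 1
    ext <;> simp
  have h2 := fderiv_comp_add_right (𝕜 := ℝ) (f := u) (x := p)
    ((0, (2*π) • (Pi.single j 1 : Fin n → ℝ)) : Pt d n)
  rw [h] at h2
  rw [h2]
  congr 1
  ext <;> simp

lemma Per.pd {d n : ℕ} {u : Pt d n → ℂ} (hu : Per d n u) (i) : Per d n (pd i u) :=
  hu.fderiv.comp (fun L => L (eb d n i))

lemma pd_contDiff {d n : ℕ} {u : Pt d n → ℂ} (hu : ContDiff ℝ 2 u) (i) :
    ContDiff ℝ 1 (pd i u) := by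
  have : ContDiff ℝ 1 (fderiv ℝ u) := hu.fderiv_right (by norm_num)
  exact this.clm_apply contDiff_const

lemma pd_cont {d n : ℕ} {u : Pt d n → ℂ} (hu : ContDiff ℝ 1 u) (i) :
    Continuous (pd i u) := by
  have : Continuous (fderiv ℝ u) := hu.continuous_fderiv (by norm_num)
  exact this.clm_apply continuous_const

lemma pd_shift {d n : ℕ} (u : Pt d n → ℂ) (i) (w : Pt d n) :
    pd i (fun z => u (z + w)) = fun z => pd i u (z + w) := by
  funext z
  simp only [pd, fderiv_comp_add_right]

lemma pd_sub {d n : ℕ} {u v : Pt d n → ℂ} (hu : ContDiff ℝ 1 u) (hv : ContDiff ℝ 1 v) (i) :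
    pd i (fun z => u z - v z) = fun z => pd i u z - pd i v z := by
  funext z
  simp only [pd]
  rw [fderiv_fun_sub (hu.differentiable (by norm_num) z) (hv.differentiable (by norm_num) z)]
  rfl

/-- Regularity class. -/
structure Good {d n : ℕ} (u : Pt d n → ℂ) : Prop where
  cd : ContDiff ℝ 2 u
  per : Per d n u
  l0 : MemLp u 2 (μP d n)
  l1 : ∀ i, MemLp (pd i u) 2 (μP d n)
  l2 : ∀ i, MemLp (pd i (pd i u)) 2 (μP d n)

lemma memLp_shift {d n : ℕ} {u : Pt d n → ℂ} (hc : Continuous u) (hu : Per d n u)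
    (h : MemLp u 2 (μP d n)) (w : Pt d n) : MemLp (fun z => u (z + w)) 2 (μP d n) := by
  rw [memLp_two_iff_integrable_sq_norm
    (by fun_prop : Continuous fun z => u (z + w)).aestronglyMeasurable]
  rw [memLp_two_iff_integrable_sq_norm hc.aestronglyMeasurable] at h
  exact (int_shift (f := fun z => ‖u z‖ ^ 2) (by fun_prop) (hu.comp (fun t => ‖t‖ ^ 2)) h w).1

lemma Good.shift {d n : ℕ} {u : Pt d n → ℂ} (h : Good u) (w : Pt d n) :
    Good (fun z => u (z + w)) where
  cd := h.cd.comp (contDiff_id.add contDiff_const)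
  per := h.per.shift w
  l0 := memLp_shift h.cd.continuous h.per h.l0 w
  l1 i := by
    rw [pd_shift]
    exact memLp_shift (pd_contDiff h.cd i).continuous (h.per.pd i) (h.l1 i) w
  l2 i := by
    rw [pd_shift, pd_shift]
    exact memLp_shift (pd_cont (pd_contDiff h.cd i) i) ((h.per.pd i).pd i) (h.l2 i) w

lemma Good.sub {d n : ℕ} {u v : Pt d n → ℂ} (h : Good u) (h' : Good v) :
    Good (fun z => u z - v z) where
  cd := h.cd.sub h'.cd
  per := fun j p => by simp only [h.per j p, h'.per j p]
  l0 := h.l0.sub h'.l0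
  l1 i := by
    rw [pd_sub (h.cd.of_le (by norm_num)) (h'.cd.of_le (by norm_num))]
    exact (h.l1 i).sub (h'.l1 i)
  l2 i := by
    rw [pd_sub (h.cd.of_le (by norm_num)) (h'.cd.of_le (by norm_num)),
      pd_sub (pd_contDiff h.cd i) (pd_contDiff h'.cd i)]
    exact (h.l2 i).sub (h'.l2 i)

/-- integral of a directional derivative vanishes -/
lemma int_deriv_zero {d n : ℕ} {F : Pt d n → ℝ} (hF : ContDiff ℝ 1 F) (hp : Per d n F)
    (e : Pt d n) (hpe : Per d n (fun z => fderiv ℝ F z e))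
    (hi : Integrable F (μP d n)) (hi' : Integrable (fun z => fderiv ℝ F z e) (μP d n)) :
    ∫ z, fderiv ℝ F z e ∂(μP d n) = 0 := by
  have hc : Continuous (fun z => fderiv ℝ F z e) :=
    (hF.continuous_fderiv (by norm_num)).clm_apply continuous_const
  rw [← (int_avg hc hpe hi' e).2]
  have : ∀ z, ∫ s in (0:ℝ)..1, fderiv ℝ F (z + s • e) e = F (z + e) - F z := by
    intro z
    have hd : ∀ s ∈ Set.uIcc (0:ℝ) 1, HasDerivAt (fun s : ℝ => F (z + s • e))
        (fderiv ℝ F (z + s • e) e) s := by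
      intro s _
      have h1 : HasFDerivAt F (fderiv ℝ F (z + s • e)) (z + s • e) :=
        (hF.differentiable (by norm_num) _).hasFDerivAt
      have h2 : HasDerivAt (fun s : ℝ => z + s • e) e s := by
        simpa using ((hasDerivAt_id s).smul_const e).const_add z
      exact h1.comp_hasDerivAt s h2
    rw [intervalIntegral.integral_eq_sub_of_hasDerivAt hd
      (Continuous.intervalIntegrable (hc.comp (by fun_prop : Continuous fun s : ℝ => z + s • e)) _ _)]
    simp
  simp only [this]
  have hs := int_shift hF.continuous hp hi e
  rw [integral_sub hs.1 hi, hs.2, sub_self]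

lemma Gs_integrable {d n : ℕ} {u : Pt d n → ℂ} (h : Good u) : Integrable (Gs u) (μP d n) := by
  unfold Gs
  refine integrable_finsetSum _ fun i _ => ?_
  exact (memLp_two_iff_integrable_sq_norm (h.l1 i).1).1 (h.l1 i)

lemma lap_memLp {d n : ℕ} {u : Pt d n → ℂ} (h : Good u) : MemLp (lap d n u) 2 (μP d n) := by
  rw [lap_eq]
  exact memLp_finsetSum _ fun i _ => h.l2 i

lemma lap_cont {d n : ℕ} {u : Pt d n → ℂ} (h : Good u) : Continuous (lap d n u) := by
  rw [lap_eq]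
  exact continuous_finsetSum _ fun i _ => pd_cont (pd_contDiff h.cd i) i

lemma lap_per {d n : ℕ} {u : Pt d n → ℂ} (h : Good u) : Per d n (lap d n u) := by
  rw [lap_eq]
  intro j p
  exact Finset.sum_congr rfl fun i _ => ((h.per.pd i).pd i) j p

lemma inner_integrable {d n : ℕ} {u v : Pt d n → ℂ} (h : MemLp u 2 (μP d n))
    (h' : MemLp v 2 (μP d n)) : Integrable (fun z => ⟪u z, v z⟫_ℝ) (μP d n) := by
  have := L2.integrable_inner (𝕜 := ℝ) (h.toLp u) (h'.toLp v)
  refine this.congr ?_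
  filter_upwards [h.coeFn_toLp, h'.coeFn_toLp] with z h1 h2
  rw [h1, h2]

lemma ibp {d n : ℕ} {v : Pt d n → ℂ} (h : Good v) :
    ∫ z, Gs v z ∂(μP d n) = - ∫ z, ⟪v z, lap d n v z⟫_ℝ ∂(μP d n) := by
  have key : ∀ i, ∫ z, (⟪v z, pd i (pd i v) z⟫_ℝ + ‖pd i v z‖ ^ 2) ∂(μP d n) = 0 := by
    intro i
    have hd : ∀ z, fderiv ℝ (fun z => ⟪v z, pd i v z⟫_ℝ) z (eb d n i) =
        ⟪v z, pd i (pd i v) z⟫_ℝ + ‖pd i v z‖ ^ 2 := by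
      intro z
      rw [fderiv_inner_apply ℝ (h.cd.differentiable (by norm_num) z)
        ((pd_contDiff h.cd i).differentiable (by norm_num) z)]
      rw [← real_inner_self_eq_norm_sq]
      rfl
    simp only [← hd]
    refine int_deriv_zero ?_ ?_ _ ?_ ?_ ?_
    · exact (h.cd.of_le (by norm_num)).inner ℝ (pd_contDiff h.cd i)
    · intro j p
      simp only [h.per j p, h.per.pd i j p]
    · simp only [hd]
      intro j p
      simp only [h.per j p, h.per.pd i j p, (h.per.pd i).pd i j p]
    · exact inner_integrable h.l0 (h.l1 i)
    · simp only [hd]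
      exact (inner_integrable h.l0 (h.l2 i)).add
        ((memLp_two_iff_integrable_sq_norm (h.l1 i).1).1 (h.l1 i))
  have h0 : ∫ z, ∑ i, (⟪v z, pd i (pd i v) z⟫_ℝ + ‖pd i v z‖ ^ 2) ∂(μP d n) = 0 := by
    rw [integral_finsetSum]
    · exact Finset.sum_eq_zero fun i _ => key i
    · intro i _
      exact (inner_integrable h.l0 (h.l2 i)).add
        ((memLp_two_iff_integrable_sq_norm (h.l1 i).1).1 (h.l1 i))
  have h1 : ∀ z, ∑ i, (⟪v z, pd i (pd i v) z⟫_ℝ + ‖pd i v z‖ ^ 2) =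
      ⟪v z, lap d n v z⟫_ℝ + Gs v z := by
    intro z
    rw [Finset.sum_add_distrib, lap_eq, inner_sum]; rfl
  simp only [h1] at h0
  rw [integral_add (inner_integrable h.l0 (lap_memLp h)) (Gs_integrable h)] at h0
  linarith

lemma sq_int_le (g : ℝ → ℝ) (hg : Continuous g) :
    (∫ s in (0:ℝ)..1, g s) ^ 2 ≤ ∫ s in (0:ℝ)..1, g s ^ 2 := by
  set m := ∫ s in (0:ℝ)..1, g s with hm
  have h0 : 0 ≤ ∫ s in (0:ℝ)..1, (g s - m) ^ 2 :=
    intervalIntegral.integral_nonneg (by norm_num) fun s _ => sq_nonneg _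
  have h1 : ∫ s in (0:ℝ)..1, (g s - m) ^ 2 = (∫ s in (0:ℝ)..1, g s ^ 2) - m ^ 2 := by
    have : ∀ s, (g s - m) ^ 2 = (g s ^ 2 - 2 * m * g s) + m ^ 2 := fun s => by ring
    simp only [this]
    rw [intervalIntegral.integral_add, intervalIntegral.integral_sub,
      intervalIntegral.integral_const_mul, ← hm]
    · simp; ring
    all_goals exact Continuous.intervalIntegrable (by fun_prop) _ _
  linarith

/-- `L²` bound on differences. -/
lemma diff_bound {d n : ℕ} {v : Pt d n → ℂ} (h : Good v) (w : Pt d n) (s : ℝ)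
    (hs : ∑ i, co w i ^ 2 ≤ s) :
    ∫ z, ‖v (z + w) - v z‖ ^ 2 ∂(μP d n) ≤ s * ∫ z, Gs v z ∂(μP d n) := by
  have hGc : Continuous (Gs v) :=
    continuous_finsetSum _ fun i _ => ((pd_contDiff h.cd i).continuous.norm.pow 2)
  have hGp : Per d n (Gs v) := fun j p => by
    unfold Gs; exact Finset.sum_congr rfl fun i _ => by rw [h.per.pd i j p]
  have hav := int_avg (f := fun z => s * Gs v z) (by fun_prop) (hGp.comp _)
    ((Gs_integrable h).const_mul s) w
  rw [← integral_const_mul, ← hav.2]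
  have hfc : Continuous (fderiv ℝ v) := h.cd.continuous_fderiv (by norm_num)
  refine integral_mono ?_ hav.1 ?_
  · exact (memLp_two_iff_integrable_sq_norm ((h.shift w).sub h).l0.1).1 ((h.shift w).sub h).l0
  intro z
  have hd : ∀ t ∈ Set.uIcc (0:ℝ) 1, HasDerivAt (fun t : ℝ => v (z + t • w))
      (fderiv ℝ v (z + t • w) w) t := by
    intro t _
    have h1 : HasFDerivAt v (fderiv ℝ v (z + t • w)) (z + t • w) :=
      (h.cd.differentiable (by norm_num) _).hasFDerivAt
    have h2 : HasDerivAt (fun t : ℝ => z + t • w) w t := by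
      simpa using ((hasDerivAt_id t).smul_const w).const_add z
    exact h1.comp_hasDerivAt t h2
  have hcc : Continuous fun t : ℝ => fderiv ℝ v (z + t • w) w :=
    (hfc.comp (by fun_prop : Continuous fun t : ℝ => z + t • w)).clm_apply continuous_const
  have hF := intervalIntegral.integral_eq_sub_of_hasDerivAt hd (hcc.intervalIntegrable _ _)
  simp only [one_smul, zero_smul, add_zero] at hF
  show ‖v (z + w) - v z‖ ^ 2 ≤ ∫ t in (0:ℝ)..1, s * Gs v (z + t • w)
  rw [← hF]
  calc _ ≤ (∫ t in (0:ℝ)..1, ‖fderiv ℝ v (z + t • w) w‖) ^ 2 := by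
        gcongr
        exact intervalIntegral.norm_integral_le_integral_norm zero_le_one
    _ ≤ ∫ t in (0:ℝ)..1, ‖fderiv ℝ v (z + t • w) w‖ ^ 2 := sq_int_le _ hcc.norm
    _ ≤ _ := by
        refine intervalIntegral.integral_mono_on zero_le_one
          (Continuous.intervalIntegrable (by fun_prop) _ _)
          (Continuous.intervalIntegrable (by fun_prop) _ _) ?_
        intro t _
        refine (fderiv_bound v _ w).trans ?_
        gcongr
        exact Finset.sum_nonneg fun i _ => by positivity

lemma lap_shift {d n : ℕ} (u : Pt d n → ℂ) (w : Pt d n) :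
    lap d n (fun z => u (z + w)) = fun z => lap d n u (z + w) := by
  simp only [lap_eq, pd_shift]

lemma lap_sub {d n : ℕ} {u v : Pt d n → ℂ} (h : Good u) (h' : Good v) :
    lap d n (fun z => u z - v z) = fun z => lap d n u z - lap d n v z := by
  simp only [lap_eq]
  funext z
  rw [← Finset.sum_sub_distrib]
  refine Finset.sum_congr rfl fun i _ => ?_
  rw [pd_sub (h.cd.of_le (by norm_num)) (h'.cd.of_le (by norm_num)),
      pd_sub (pd_contDiff h.cd i) (pd_contDiff h'.cd i)]

lemma inner_young (a b : ℂ) (t : ℝ) (ht : 0 < t) :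
    -⟪a, b⟫_ℝ ≤ (1 / (2 * t)) * ‖a‖ ^ 2 + (t / 2) * ‖b‖ ^ 2 := by
  have h1 : -⟪a, b⟫_ℝ ≤ ‖a‖ * ‖b‖ := by
    have := abs_real_inner_le_norm a b
    have := neg_abs_le ⟪a, b⟫_ℝ
    linarith
  have h2 : (1 / (2 * t)) * ‖a‖ ^ 2 + (t / 2) * ‖b‖ ^ 2 - ‖a‖ * ‖b‖
      = (‖a‖ - t * ‖b‖) ^ 2 / (2 * t) := by
    field_simp; ring
  have h3 : 0 ≤ (‖a‖ - t * ‖b‖) ^ 2 / (2 * t) := by positivity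
  linarith

lemma young_int {d n : ℕ} {a b : Pt d n → ℂ} (ha : MemLp a 2 (μP d n))
    (hb : MemLp b 2 (μP d n)) (t : ℝ) (ht : 0 < t) :
    - ∫ z, ⟪a z, b z⟫_ℝ ∂(μP d n) ≤
      (1 / (2 * t)) * (∫ z, ‖a z‖ ^ 2 ∂(μP d n)) + (t / 2) * ∫ z, ‖b z‖ ^ 2 ∂(μP d n) := by
  have ha' := (memLp_two_iff_integrable_sq_norm ha.1).1 ha
  have hb' := (memLp_two_iff_integrable_sq_norm hb.1).1 hb
  rw [← integral_neg, ← integral_const_mul, ← integral_const_mul,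
    ← integral_add (ha'.const_mul _) (hb'.const_mul _)]
  exact integral_mono (inner_integrable ha hb).neg
    ((ha'.const_mul _).add (hb'.const_mul _)) fun z => inner_young _ _ t ht

lemma grad_bound {d n : ℕ} {u : Pt d n → ℂ} (h : Good u) (t : ℝ) (ht : 0 < t) :
    ∫ z, Gs u z ∂(μP d n) ≤ (1 / (2 * t)) * Mass d n u + (t / 2) * lapSq d n u := by
  rw [ibp h]
  exact young_int h.l0 (lap_memLp h) t ht

lemma grad_diff_bound {d n : ℕ} {u : Pt d n → ℂ} (h : Good u) (w : Pt d n) (s : ℝ)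
    (hs0 : 0 < s) (hs : ∑ i, co w i ^ 2 ≤ s) :
    ∫ z, Gs (fun z => u (z + w) - u z) z ∂(μP d n) ≤ s * lapSq d n u := by
  set v : Pt d n → ℂ := fun z => u (z + w) - u z with hv
  have hgv : Good v := (h.shift w).sub h
  have hlap : lap d n v = fun z => lap d n u (z + w) - lap d n u z := by
    rw [hv, lap_sub (h.shift w) h, lap_shift]
  have hvm : Good (fun z => v (z + -w)) := hgv.shift (-w)
  -- discrete integration by parts
  have hL := lap_memLp h
  have hLs : MemLp (fun z => lap d n u (z + w)) 2 (μP d n) :=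
    memLp_shift (lap_cont h) (lap_per h) hL w
  have hsh : ∫ z, ⟪v z, lap d n u (z + w)⟫_ℝ ∂(μP d n) =
      ∫ z, ⟪v (z + -w), lap d n u z⟫_ℝ ∂(μP d n) := by
    have := (int_shift (f := fun z => ⟪v (z + -w), lap d n u z⟫_ℝ)
      (hvm.cd.continuous.inner (lap_cont h))
      (fun j p => by
        have h1 := hvm.per j p
        have h2 := lap_per h j p
        exact congrArg₂ (fun a b => ⟪a, b⟫_ℝ) h1 h2)
      (inner_integrable hvm.l0 hL) w).2
    rw [← this]
    simp
  have e1 : ∫ z, Gs v z ∂(μP d n) =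
      - ∫ z, ⟪v (z + -w) - v z, lap d n u z⟫_ℝ ∂(μP d n) := by
    rw [ibp hgv, hlap]
    simp only [inner_sub_left, inner_sub_right]
    rw [integral_sub (inner_integrable hgv.l0 hLs) (inner_integrable hgv.l0 hL), hsh,
      integral_sub (inner_integrable hvm.l0 hL) (inner_integrable hgv.l0 hL)]
  have e2 := young_int (hvm.l0.sub hgv.l0) hL s hs0
  have e3 := diff_bound hgv (-w) s (by
    refine le_trans (le_of_eq ?_) hs
    refine Finset.sum_congr rfl fun i _ => ?_
    rcases i with i | i <;> simp [co])
  simp only [Pi.sub_apply] at e2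
  rw [← e1] at e2
  have e4 : 1 / (2 * s) * ∫ z, ‖v (z + -w) - v z‖ ^ 2 ∂(μP d n) ≤
      1 / (2 * s) * (s * ∫ z, Gs v z ∂(μP d n)) := by gcongr
  have e5 : 1 / (2 * s) * (s * ∫ z, Gs v z ∂(μP d n)) = (∫ z, Gs v z ∂(μP d n)) / 2 := by
    field_simp
  have e6 : lapSq d n u = ∫ z, ‖lap d n u z‖ ^ 2 ∂(μP d n) := rfl
  rw [e6]
  linarith

lemma second_diff_bound {d n : ℕ} {u : Pt d n → ℂ} (h : Good u) (w w' : Pt d n) (s : ℝ)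
    (hs0 : 0 < s) (hs : ∑ i, co w i ^ 2 ≤ s) (hs' : ∑ i, co w' i ^ 2 ≤ s) :
    ∫ z, ‖(u (z + w' + w) - u (z + w')) - (u (z + w) - u z)‖ ^ 2 ∂(μP d n)
      ≤ s ^ 2 * lapSq d n u := by
  have h1 := diff_bound ((h.shift w).sub h) w' s hs'
  have h2 := grad_diff_bound h w s hs0 hs
  calc _ ≤ _ := h1
    _ ≤ s * (s * lapSq d n u) := by gcongr
    _ = _ := by ring

lemma second_diff_integrable {d n : ℕ} {u : Pt d n → ℂ} (h : Good u) (w w' : Pt d n) :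
    Integrable (fun z => ‖(u (z + w' + w) - u (z + w')) - (u (z + w) - u z)‖ ^ 2) (μP d n) := by
  have hg := (((h.shift w).sub h).shift w').sub ((h.shift w).sub h)
  exact (memLp_two_iff_integrable_sq_norm hg.l0.1).1 hg.l0

end BNLS

namespace BNLS

open scoped ENNReal Pointwise InnerProductSpace

/-- The cube of side `h`. -/
def Bx (d n : ℕ) (h : ℝ) : Set (Pt d n) :=
  (Set.univ.pi fun _ => Set.Ico 0 h) ×ˢ (Set.univ.pi fun _ => Set.Ico 0 h)

lemma Bx_meas (d n : ℕ) (h : ℝ) : MeasurableSet (Bx d n h) :=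
  (MeasurableSet.univ_pi fun _ => measurableSet_Ico).prod
    (MeasurableSet.univ_pi fun _ => measurableSet_Ico)

lemma Bx_vol (d n : ℕ) (h : ℝ) (h0 : 0 < h) (h1 : h ≤ 2 * π) :
    μP d n (Bx d n h) = ENNReal.ofReal (h ^ (d + n)) := by
  unfold μP Bx
  rw [Measure.prod_prod]
  unfold μT
  rw [Measure.restrict_apply (MeasurableSet.univ_pi fun _ => measurableSet_Ico),
    Set.inter_eq_left.2, Real.volume_pi_Ico, Real.volume_pi_Ico]
  · simp [pow_add, ENNReal.ofReal_mul, h0.le, ENNReal.ofReal_pow]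
  · unfold torusBox
    exact Set.pi_mono fun i _ => Set.Ico_subset_Ico_right h1

lemma Bx_co {d n : ℕ} {h : ℝ} {w : Pt d n} (hw : w ∈ Bx d n h) :
    ∑ i, co w i ^ 2 ≤ ((d:ℝ) + n) * h ^ 2 := by
  have : ∀ i, co w i ^ 2 ≤ h ^ 2 := by
    intro i
    have : 0 ≤ co w i ∧ co w i < h := by
      rcases i with i | i
      · exact hw.1 i (Set.mem_univ _)
      · exact hw.2 i (Set.mem_univ _)
    exact pow_le_pow_left₀ this.1 this.2.le 2
  refine (Finset.sum_le_sum fun i _ => this i).trans (le_of_eq ?_)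
  simp

lemma four_sq (a b c e : ℂ) :
    ‖a‖ ^ 2 ≤ 4 * (‖(b - c) - (e - a)‖ ^ 2 + ‖b‖ ^ 2 + ‖c‖ ^ 2 + ‖e‖ ^ 2) := by
  have h1 : ‖a‖ ≤ ‖(b - c) - (e - a)‖ + ‖b‖ + ‖c‖ + ‖e‖ := by
    calc ‖a‖ = ‖((b - c) - (e - a)) - b + c + e‖ := by congr 1; ring
      _ ≤ ‖((b - c) - (e - a)) - b + c‖ + ‖e‖ := norm_add_le _ _
      _ ≤ ‖((b - c) - (e - a)) - b‖ + ‖c‖ + ‖e‖ := by gcongr; exact norm_add_le _ _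
      _ ≤ _ := by gcongr; exact norm_sub_le _ _
  generalize ‖(b - c) - (e - a)‖ = x at *
  have h2 : ‖a‖ ^ 2 ≤ (x + ‖b‖ + ‖c‖ + ‖e‖) ^ 2 := by gcongr
  nlinarith [sq_nonneg (x - ‖b‖), sq_nonneg (x - ‖c‖), sq_nonneg (x - ‖e‖),
    sq_nonneg (‖b‖ - ‖c‖), sq_nonneg (‖b‖ - ‖e‖), sq_nonneg (‖c‖ - ‖e‖)]

lemma lint_mass {d n : ℕ} {u : Pt d n → ℂ} (hu : Good u) :
    ∫⁻ z, ENNReal.ofReal (‖u z‖ ^ 2) ∂(μP d n) = ENNReal.ofReal (Mass d n u) := by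
  unfold Mass
  rw [ofReal_integral_eq_lintegral_ofReal]
  · exact (memLp_two_iff_integrable_sq_norm hu.l0.1).1 hu.l0
  · exact ae_of_all _ fun z => by positivity

lemma local_bound {d n : ℕ} {u : Pt d n → ℂ} (hu : Good u) (hD : 1 ≤ d + n) (h : ℝ) (h0 : 0 < h)
    (h1 : h ≤ 2 * π) :
    ∃ K : Pt d n → ℝ≥0∞, Measurable K ∧
      (∀ z, 24 * Mass d n u ≤ h ^ (d + n) * ‖u z‖ ^ 2 → ENNReal.ofReal (‖u z‖ ^ 2) ≤ K z) ∧
      ∫⁻ z, K z ∂(μP d n) ≤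
        ENNReal.ofReal (8 * (((d:ℝ) + n) ^ 2 * h ^ 4 * lapSq d n u)) := by
  have hcu : Continuous u := hu.cd.continuous
  have hM0 : 0 ≤ Mass d n u := integral_nonneg fun z => by positivity
  set ν := (μP d n).restrict (Bx d n h) with hν
  set V : ℝ := h ^ (d + n) with hV
  have hV0 : 0 < V := by positivity
  have hνu : ν Set.univ = ENNReal.ofReal V := by
    rw [hν, Measure.restrict_apply_univ, Bx_vol d n h h0 h1]
  set Q : Pt d n → Pt d n × Pt d n → ℝ := fun z q =>
    ‖(u (z + q.1 + q.2) - u (z + q.1)) - (u (z + q.2) - u z)‖ ^ 2 with hQ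
  have hQc : Continuous (Function.uncurry Q) := by
    simp only [hQ, Function.uncurry_def]; fun_prop
  set G : Pt d n → ℝ≥0∞ := fun z => ∫⁻ q, ENNReal.ofReal (Q z q) ∂(ν.prod ν) with hG
  have hGm : Measurable G := by
    have : Measurable (fun p : Pt d n × (Pt d n × Pt d n) => ENNReal.ofReal (Q p.1 p.2)) :=
      hQc.measurable.ennreal_ofReal
    exact this.lintegral_prod_right'
  have hV2 : ENNReal.ofReal (V ^ 2) ≠ 0 := by
    simp only [ne_eq, ENNReal.ofReal_eq_zero, not_le]; positivity
  have hνν : (ν.prod ν) Set.univ = ENNReal.ofReal (V ^ 2) := by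
    rw [← Set.univ_prod_univ, Measure.prod_prod, hνu, ← ENNReal.ofReal_mul hV0.le, sq]
  refine ⟨fun z => 8 * G z / ENNReal.ofReal (V ^ 2), (hGm.const_mul 8).div_const _, ?_, ?_⟩
  · intro z hz
    -- mass over one cube
    have hmass : ∀ p : Pt d n, ∫⁻ w, ENNReal.ofReal (‖u (p + w)‖ ^ 2) ∂ν ≤
        ENNReal.ofReal (Mass d n u) := by
      intro p
      rw [← lint_mass hu, ← lint_shift d n (fun z => ENNReal.ofReal (‖u z‖ ^ 2))
        (by fun_prop) (hu.per.comp (fun t => ENNReal.ofReal (‖t‖ ^ 2))) p]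
      simp only [add_comm p]
      exact lintegral_mono' Measure.restrict_le_self le_rfl
    have i1 : ∫⁻ q, ENNReal.ofReal (‖u (z + q.1 + q.2)‖ ^ 2) ∂(ν.prod ν) ≤
        ENNReal.ofReal (V * Mass d n u) := by
      rw [lintegral_prod _ (by fun_prop)]
      calc _ ≤ ∫⁻ _w : Pt d n, ENNReal.ofReal (Mass d n u) ∂ν :=
            lintegral_mono fun w => hmass (z + w)
        _ = _ := by rw [lintegral_const, hνu, mul_comm, ENNReal.ofReal_mul hV0.le]
    have i2 : ∫⁻ q, ENNReal.ofReal (‖u (z + q.1)‖ ^ 2) ∂(ν.prod ν) ≤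
        ENNReal.ofReal (V * Mass d n u) := by
      rw [lintegral_prod _ (by fun_prop)]
      simp only [lintegral_const, hνu]
      rw [lintegral_mul_const _ (by fun_prop), mul_comm, ENNReal.ofReal_mul hV0.le]
      gcongr
      exact hmass z
    have i3 : ∫⁻ q, ENNReal.ofReal (‖u (z + q.2)‖ ^ 2) ∂(ν.prod ν) ≤
        ENNReal.ofReal (V * Mass d n u) := by
      rw [lintegral_prod _ (by fun_prop)]
      calc _ ≤ ∫⁻ _w : Pt d n, ENNReal.ofReal (Mass d n u) ∂ν :=
            lintegral_mono fun w => hmass z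
        _ = _ := by rw [lintegral_const, hνu, mul_comm, ENNReal.ofReal_mul hV0.le]
    have main : ENNReal.ofReal (‖u z‖ ^ 2) * ENNReal.ofReal (V ^ 2) ≤
        4 * (G z + ENNReal.ofReal (V * Mass d n u) + ENNReal.ofReal (V * Mass d n u)
          + ENNReal.ofReal (V * Mass d n u)) := by
      calc _ = ∫⁻ _q : Pt d n × Pt d n, ENNReal.ofReal (‖u z‖ ^ 2) ∂(ν.prod ν) := by
            rw [lintegral_const, hνν]
        _ ≤ ∫⁻ q, 4 * (ENNReal.ofReal (Q z q) + ENNReal.ofReal (‖u (z + q.1 + q.2)‖ ^ 2)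
            + ENNReal.ofReal (‖u (z + q.1)‖ ^ 2)
            + ENNReal.ofReal (‖u (z + q.2)‖ ^ 2)) ∂(ν.prod ν) := by
            refine lintegral_mono fun q => ?_
            have := ENNReal.ofReal_le_ofReal
              (four_sq (u z) (u (z + q.1 + q.2)) (u (z + q.1)) (u (z + q.2)))
            refine this.trans (le_of_eq ?_)
            rw [ENNReal.ofReal_mul (by norm_num), ENNReal.ofReal_add (by positivity) (by positivity),
              ENNReal.ofReal_add (by positivity) (by positivity),
              ENNReal.ofReal_add (by positivity) (by positivity)]
            simp [hQ]
        _ = 4 * (G z + (∫⁻ q, ENNReal.ofReal (‖u (z + q.1 + q.2)‖ ^ 2) ∂(ν.prod ν))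
            + (∫⁻ q, ENNReal.ofReal (‖u (z + q.1)‖ ^ 2) ∂(ν.prod ν))
            + (∫⁻ q, ENNReal.ofReal (‖u (z + q.2)‖ ^ 2) ∂(ν.prod ν))) := by
            rw [lintegral_const_mul' _ _ (by norm_num), lintegral_add_right _ (by fun_prop),
              lintegral_add_right _ (by fun_prop), lintegral_add_right _ (by fun_prop)]
        _ ≤ _ := by gcongr
    rw [ENNReal.le_div_iff_mul_le (Or.inl hV2) (Or.inl ENNReal.ofReal_ne_top)]
    by_cases hT : G z = ⊤
    · rw [hT]; simp
    obtain ⟨g, hg0, hg⟩ : ∃ g : ℝ, 0 ≤ g ∧ G z = ENNReal.ofReal g :=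
      ⟨(G z).toReal, ENNReal.toReal_nonneg, (ENNReal.ofReal_toReal hT).symm⟩
    rw [hg] at main ⊢
    have e4 : (4 : ℝ≥0∞) = ENNReal.ofReal 4 := by simp
    have e8 : (8 : ℝ≥0∞) = ENNReal.ofReal 8 := by simp
    have hVM : 0 ≤ V * Mass d n u := by positivity
    rw [e4, ← ENNReal.ofReal_add hg0 hVM, ← ENNReal.ofReal_add (by positivity) hVM,
      ← ENNReal.ofReal_add (by positivity) hVM, ← ENNReal.ofReal_mul (by norm_num),
      ← ENNReal.ofReal_mul (by positivity), ENNReal.ofReal_le_ofReal_iff (by positivity)] at main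
    rw [e8, ← ENNReal.ofReal_mul (by norm_num), ← ENNReal.ofReal_mul (by positivity)]
    apply ENNReal.ofReal_le_ofReal
    have := mul_le_mul_of_nonneg_left hz hV0.le
    nlinarith
  · have hs0 : (0:ℝ) < ((d:ℝ) + n) * h ^ 2 := by
      have : (1:ℝ) ≤ (d:ℝ) + n := by exact_mod_cast hD
      positivity
    have hL0 : 0 ≤ lapSq d n u := integral_nonneg fun z => by positivity
    have hGi : ∫⁻ z, G z ∂(μP d n) ≤
        ENNReal.ofReal ((((d:ℝ) + n) * h ^ 2) ^ 2 * lapSq d n u) * ENNReal.ofReal (V ^ 2) := by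
      simp only [hG]
      rw [lintegral_lintegral_swap hQc.measurable.ennreal_ofReal.aemeasurable, ← hνν,
        ← lintegral_const]
      refine lintegral_mono_ae ?_
      have hmem : ∀ᵐ q ∂(ν.prod ν), q ∈ Bx d n h ×ˢ Bx d n h := by
        rw [hν, Measure.prod_restrict]
        exact ae_restrict_mem ((Bx_meas d n h).prod (Bx_meas d n h))
      filter_upwards [hmem] with q hq
      rw [← ofReal_integral_eq_lintegral_ofReal]
      · exact ENNReal.ofReal_le_ofReal
          (second_diff_bound hu q.2 q.1 _ hs0 (Bx_co hq.2) (Bx_co hq.1))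
      · exact second_diff_integrable hu q.2 q.1
      · exact ae_of_all _ fun z => by simp only [hQ, Pi.zero_apply]; positivity
    simp only [div_eq_mul_inv]
    rw [lintegral_mul_const _ (hGm.const_mul 8), lintegral_const_mul _ hGm, ← div_eq_mul_inv]
    apply ENNReal.div_le_of_le_mul
    rw [ENNReal.ofReal_mul (by norm_num), mul_assoc]
    have e8 : (8 : ℝ≥0∞) = ENNReal.ofReal 8 := by simp
    rw [← e8]
    gcongr
    refine hGi.trans (le_of_eq ?_)
    congr 2
    ring

end BNLS

namespace BNLS

open scoped ENNReal Pointwise InnerProductSpace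

lemma tsum_geo_bound {d n : ℕ} (α M h₀ L : ℝ) (hα : 0 < α)
    (hγ : 0 < 4 - ((d:ℝ) + n) * α / 2) (hM : 0 < M) (hh : 0 < h₀) (hL : 0 ≤ L) :
    ∑' k : ℕ, ENNReal.ofReal ((24 * M / (h₀ * (1/2) ^ (k+1)) ^ (d + n)) ^ (α / 2)) *
        ENNReal.ofReal (8 * (((d:ℝ) + n) ^ 2 * (h₀ * (1/2) ^ k) ^ 4 * L)) ≤
      ENNReal.ofReal ((24 * M * 2 ^ (d + n)) ^ (α / 2) * 8 * ((d:ℝ) + n) ^ 2 *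
        (1 - (1/2 : ℝ) ^ (4 - ((d:ℝ) + n) * α / 2))⁻¹ * h₀ ^ (4 - ((d:ℝ) + n) * α / 2) * L) := by
  set γ := 4 - ((d:ℝ) + n) * α / 2 with hγd
  have hr0 : (0:ℝ) ≤ (1/2 : ℝ) ^ γ := by positivity
  have hr1 : (1/2 : ℝ) ^ γ < 1 := Real.rpow_lt_one (by norm_num) (by norm_num) hγ
  set A : ℝ := (24 * M * 2 ^ (d + n)) ^ (α / 2) * 8 * ((d:ℝ) + n) ^ 2 * h₀ ^ γ * L with hA
  have hA0 : 0 ≤ A := by positivity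
  have key : ∀ k : ℕ, ENNReal.ofReal ((24 * M / (h₀ * (1/2) ^ (k+1)) ^ (d + n)) ^ (α / 2)) *
        ENNReal.ofReal (8 * (((d:ℝ) + n) ^ 2 * (h₀ * (1/2) ^ k) ^ 4 * L)) =
      ENNReal.ofReal (A * ((1/2 : ℝ) ^ γ) ^ k) := by
    intro k
    rw [← ENNReal.ofReal_mul (by positivity)]
    congr 1
    set t : ℝ := h₀ * (1/2) ^ k with ht
    have ht0 : 0 < t := by positivity
    have e1 : 24 * M / (h₀ * (1/2) ^ (k+1)) ^ (d + n) = 24 * M * 2 ^ (d + n) * (t ^ (d + n))⁻¹ := by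
      have : h₀ * (1/2) ^ (k+1) = t / 2 := by rw [ht, pow_succ]; ring
      rw [this, div_pow]; field_simp
    have e2 : ((t ^ (d + n))⁻¹) ^ (α / 2) * t ^ 4 = t ^ γ := by
      rw [← Real.rpow_natCast t (d + n), ← Real.rpow_neg ht0.le, ← Real.rpow_mul ht0.le,
        ← Real.rpow_natCast t 4, ← Real.rpow_add ht0]
      congr 1
      rw [hγd]; push_cast; ring
    have e3 : t ^ γ = h₀ ^ γ * ((1/2 : ℝ) ^ γ) ^ k := by
      rw [ht, Real.mul_rpow hh.le (by positivity)]
      congr 1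
      rw [← Real.rpow_natCast, ← Real.rpow_mul (by norm_num), mul_comm,
        Real.rpow_mul (by norm_num), Real.rpow_natCast]
    rw [e1, Real.mul_rpow (by positivity) (by positivity)]
    calc _ = (24 * M * 2 ^ (d + n)) ^ (α / 2) * 8 * ((d:ℝ) + n) ^ 2 * L *
          (((t ^ (d + n))⁻¹) ^ (α / 2) * t ^ 4) := by ring
      _ = _ := by rw [e2, e3, hA]; ring
  simp only [key]
  have hs : Summable fun k : ℕ => A * ((1/2 : ℝ) ^ γ) ^ k :=
    (summable_geometric_of_lt_one hr0 hr1).mul_left A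
  rw [← ENNReal.ofReal_tsum_of_nonneg (fun k => by positivity) hs, tsum_mul_left,
    tsum_geometric_of_lt_one hr0 hr1]
  apply ENNReal.ofReal_le_ofReal
  rw [hA]
  apply le_of_eq; ring

lemma Npow_bound {d n : ℕ} {u : Pt d n → ℂ} (hu : Good u) (hD : 1 ≤ d + n) (α h₀ : ℝ)
    (hα : 0 < α) (hγ : 0 < 4 - ((d:ℝ) + n) * α / 2) (hM : 0 < Mass d n u)
    (hh : 0 < h₀) (hh' : h₀ ≤ 2 * π) :
    Npow d n (α + 2) u ≤ (24 * Mass d n u / h₀ ^ (d + n)) ^ (α / 2) * Mass d n u +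
      (24 * Mass d n u * 2 ^ (d + n)) ^ (α / 2) * 8 * ((d:ℝ) + n) ^ 2 *
        (1 - (1/2 : ℝ) ^ (4 - ((d:ℝ) + n) * α / 2))⁻¹ * h₀ ^ (4 - ((d:ℝ) + n) * α / 2)
        * lapSq d n u := by
  set M := Mass d n u with hMd
  set H : ℕ → ℝ := fun k => h₀ * (1/2) ^ k with hH
  have hH0 : ∀ k, 0 < H k := fun k => by simp only [hH]; positivity
  have hH1 : ∀ k, H k ≤ 2 * π := fun k => by
    refine le_trans ?_ hh'
    simp only [hH]
    exact mul_le_of_le_one_right hh.le (pow_le_one₀ (by norm_num) (by norm_num))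
  have hL0 : 0 ≤ lapSq d n u := integral_nonneg fun z => by positivity
  have hr1 : (1/2 : ℝ) ^ (4 - ((d:ℝ) + n) * α / 2) < 1 :=
    Real.rpow_lt_one (by norm_num) (by norm_num) hγ
  have hr2 : 0 ≤ (1 - (1/2 : ℝ) ^ (4 - ((d:ℝ) + n) * α / 2))⁻¹ :=
    inv_nonneg.2 (by linarith)
  choose K hKm hK1 hK2 using fun k => local_bound hu hD (H k) (hH0 k) (hH1 k)
  set lam : ℕ → ℝ := fun k => 24 * M / (H k) ^ (d + n) with hlam
  have hlam0 : ∀ k, 0 < lam k := fun k => by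
    have := hH0 k
    simp only [hlam]; positivity
  have hpw : ∀ z, ENNReal.ofReal (‖u z‖ ^ (α + 2)) ≤
      ENNReal.ofReal (lam 0 ^ (α / 2)) * ENNReal.ofReal (‖u z‖ ^ 2) +
        ∑' k, ENNReal.ofReal (lam (k+1) ^ (α / 2)) * K k z := by
    intro z
    have e : ‖u z‖ ^ (α + 2) = (‖u z‖ ^ 2) ^ (α / 2) * ‖u z‖ ^ 2 := by
      rcases eq_or_lt_of_le (norm_nonneg (u z)) with h | h
      · rw [← h, Real.zero_rpow (by linarith)]; simp
      · rw [← Real.rpow_natCast, ← Real.rpow_mul h.le, ← Real.rpow_add h]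
        congr 1; push_cast; ring
    rw [e]
    set a := ‖u z‖ ^ 2 with ha
    have ha0 : 0 ≤ a := by positivity
    have step : ∀ k, a < lam k → ENNReal.ofReal (a ^ (α / 2) * a) ≤
        ENNReal.ofReal (lam k ^ (α / 2)) * ENNReal.ofReal a := by
      intro k hk
      rw [← ENNReal.ofReal_mul (Real.rpow_nonneg (hlam0 k).le _)]
      apply ENNReal.ofReal_le_ofReal
      gcongr
    by_cases h0 : a < lam 0
    · exact (step 0 h0).trans le_self_add
    have hex : ∃ k, a < lam k := by
      have h2 : Tendsto (fun k => H k ^ (d + n)) atTop (nhds 0) := by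
        have : Tendsto H atTop (nhds 0) := by
          simpa [hH] using (tendsto_pow_atTop_nhds_zero_of_lt_one
            (by norm_num : (0:ℝ) ≤ 1/2) (by norm_num)).const_mul h₀
        have h3 := this.pow (d + n)
        rwa [zero_pow (by omega)] at h3
      have h4 : ∀ᶠ k in atTop, H k ^ (d + n) < 24 * M / (a + 1) :=
        h2.eventually_lt_const (by positivity)
      obtain ⟨k, hk⟩ := h4.exists
      refine ⟨k, ?_⟩
      have hp : 0 < H k ^ (d + n) := pow_pos (hH0 k) _
      simp only [hlam]
      rw [lt_div_iff₀ hp]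
      rw [lt_div_iff₀ (by positivity)] at hk
      nlinarith
    classical
    obtain ⟨k, hk⟩ : ∃ k, Nat.find hex = k + 1 := by
      refine Nat.exists_eq_succ_of_ne_zero ?_
      intro h
      have := Nat.find_spec hex
      rw [h] at this
      exact h0 this
    have k1 : a < lam (k+1) := hk ▸ Nat.find_spec hex
    have k2 : lam k ≤ a := not_lt.1 (Nat.find_min hex (by omega))
    have k3 : ENNReal.ofReal a ≤ K k z := by
      apply hK1 k z
      have hp : 0 < H k ^ (d + n) := pow_pos (hH0 k) _
      simp only [hlam] at k2
      rw [div_le_iff₀ hp] at k2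
      linarith
    calc _ ≤ _ := step (k+1) k1
      _ ≤ ENNReal.ofReal (lam (k+1) ^ (α / 2)) * K k z := by gcongr
      _ ≤ ∑' k, ENNReal.ofReal (lam (k+1) ^ (α / 2)) * K k z :=
          ENNReal.le_tsum (f := fun k => ENNReal.ofReal (lam (k+1) ^ (α / 2)) * K k z) k
      _ ≤ _ := le_add_self
  have hcu : Continuous u := hu.cd.continuous
  have hint : ∫⁻ z, ENNReal.ofReal (‖u z‖ ^ (α + 2)) ∂(μP d n) ≤
      ENNReal.ofReal ((24 * M / h₀ ^ (d + n)) ^ (α / 2) * M +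
      (24 * M * 2 ^ (d + n)) ^ (α / 2) * 8 * ((d:ℝ) + n) ^ 2 *
        (1 - (1/2 : ℝ) ^ (4 - ((d:ℝ) + n) * α / 2))⁻¹ * h₀ ^ (4 - ((d:ℝ) + n) * α / 2)
        * lapSq d n u) := by
    calc _ ≤ _ := lintegral_mono hpw
      _ = ENNReal.ofReal (lam 0 ^ (α / 2)) * ENNReal.ofReal M +
          ∑' k, ENNReal.ofReal (lam (k+1) ^ (α / 2)) * ∫⁻ z, K k z ∂(μP d n) := by
          rw [lintegral_add_left (by fun_prop), lintegral_const_mul _ (by fun_prop), lint_mass hu,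
            lintegral_tsum (fun k => ((hKm k).const_mul _).aemeasurable)]
          congr 2
          funext k
          rw [lintegral_const_mul _ (hKm k)]
      _ ≤ ENNReal.ofReal (lam 0 ^ (α / 2)) * ENNReal.ofReal M +
          ∑' k, ENNReal.ofReal (lam (k+1) ^ (α / 2)) *
            ENNReal.ofReal (8 * (((d:ℝ) + n) ^ 2 * H k ^ 4 * lapSq d n u)) := by
          gcongr with k
          exact hK2 k
      _ ≤ _ := by
          rw [ENNReal.ofReal_add (by positivity) (by positivity)]
          refine add_le_add (le_of_eq ?_) (tsum_geo_bound α M h₀ _ hα hγ hM hh hL0)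
          rw [← ENNReal.ofReal_mul (Real.rpow_nonneg (hlam0 0).le _)]
          simp [hlam, hH]
  unfold Npow
  rw [integral_eq_lintegral_of_nonneg_ae (ae_of_all _ fun z => by positivity)]
  · exact ENNReal.toReal_le_of_le_ofReal (by positivity) hint
  · exact (hcu.norm.rpow_const fun z => Or.inr (by linarith)).aestronglyMeasurable

lemma pd_inl {d n : ℕ} (i : Fin d) (u : Pt d n → ℂ) : pd (Sum.inl i) u = dX d n i u := rfl
lemma pd_inr {d n : ℕ} (i : Fin n) (u : Pt d n → ℂ) : pd (Sum.inr i) u = dY d n i u := rfl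

lemma InH2.good {d n : ℕ} {u : Pt d n → ℂ} (h : InH2 d n u) : Good u := by
  obtain ⟨h1, h2, h3, h4, h5⟩ := h
  have c1 : ∀ i, Continuous (pd i u) := fun i => (pd_contDiff h1 i).continuous
  have c2 : ∀ i, Continuous (pd i (pd i u)) := fun i => pd_cont (pd_contDiff h1 i) i
  refine ⟨h1, h2, ?_, ?_, ?_⟩
  · exact (memLp_two_iff_integrable_sq_norm h1.continuous.aestronglyMeasurable).2 h3
  · intro i
    refine (memLp_two_iff_integrable_sq_norm (c1 i).aestronglyMeasurable).2 ?_
    refine h4.mono' ((c1 i).norm.pow 2).aestronglyMeasurable (ae_of_all _ fun z => ?_)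
    rw [Real.norm_of_nonneg (by positivity)]
    have : (∑ i, ‖dX d n i u z‖^2) + ∑ j, ‖dY d n j u z‖^2 = ∑ i, ‖pd i u z‖ ^ 2 := by
      rw [Fintype.sum_sum_type]; rfl
    rw [this]
    exact Finset.single_le_sum (f := fun i => ‖pd i u z‖ ^ 2) (fun i _ => by positivity)
      (Finset.mem_univ i)
  · intro i
    refine (memLp_two_iff_integrable_sq_norm (c2 i).aestronglyMeasurable).2 ?_
    refine h5.mono' ((c2 i).norm.pow 2).aestronglyMeasurable (ae_of_all _ fun z => ?_)
    rw [Real.norm_of_nonneg (by positivity)]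
    unfold hessInt
    have n2 : 0 ≤ ∑ i, ∑ j, ‖dY d n j (dX d n i u) z‖^2 := by positivity
    have n3 : 0 ≤ ∑ j, ∑ i, ‖dX d n i (dY d n j u) z‖^2 := by positivity
    have n1 : 0 ≤ ∑ i, ∑ i', ‖dX d n i (dX d n i' u) z‖^2 := by positivity
    have n4 : 0 ≤ ∑ j, ∑ j', ‖dY d n j (dY d n j' u) z‖^2 := by positivity
    rcases i with i | i
    · have a1 : ‖dX d n i (dX d n i u) z‖^2 ≤ ∑ i', ‖dX d n i (dX d n i' u) z‖^2 :=
        Finset.single_le_sum (f := fun i' => ‖dX d n i (dX d n i' u) z‖^2)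
          (fun _ _ => by positivity) (Finset.mem_univ i)
      have a2 : ∑ i', ‖dX d n i (dX d n i' u) z‖^2 ≤
          ∑ i, ∑ i', ‖dX d n i (dX d n i' u) z‖^2 :=
        Finset.single_le_sum (f := fun i => ∑ i', ‖dX d n i (dX d n i' u) z‖^2)
          (fun _ _ => by positivity) (Finset.mem_univ i)
      rw [pd_inl, pd_inl]
      linarith
    · have a1 : ‖dY d n i (dY d n i u) z‖^2 ≤ ∑ i', ‖dY d n i (dY d n i' u) z‖^2 :=
        Finset.single_le_sum (f := fun i' => ‖dY d n i (dY d n i' u) z‖^2)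
          (fun _ _ => by positivity) (Finset.mem_univ i)
      have a2 : ∑ i', ‖dY d n i (dY d n i' u) z‖^2 ≤
          ∑ i, ∑ i', ‖dY d n i (dY d n i' u) z‖^2 :=
        Finset.single_le_sum (f := fun i => ∑ i', ‖dY d n i (dY d n i' u) z‖^2)
          (fun _ _ => by positivity) (Finset.mem_univ i)
      rw [pd_inr, pd_inr]
      linarith

lemma gradSq_eq {d n : ℕ} {u : Pt d n → ℂ} (h : Good u) :
    gradSq d n u = ∫ z, Gs u z ∂(μP d n) := by
  unfold gradSq gradXSq gradYSq Gs
  rw [← integral_add]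
  · congr 1; funext z; rw [Fintype.sum_sum_type]; rfl
  · exact integrable_finsetSum _ fun i _ =>
      (memLp_two_iff_integrable_sq_norm (h.l1 (Sum.inl i)).1).1 (h.l1 (Sum.inl i))
  · exact integrable_finsetSum _ fun i _ =>
      (memLp_two_iff_integrable_sq_norm (h.l1 (Sum.inr i)).1).1 (h.l1 (Sum.inr i))

lemma En_bdd (d n : ℕ) (hD : 1 ≤ d + n) (β α c : ℝ) (hα : 0 < α)
    (hα' : α < 8 / ((d:ℝ) + n)) (hc : 0 < c) :
    BddBelow (En d n β α '' Sset d n c) := by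
  have hDr : (1:ℝ) ≤ (d:ℝ) + n := by exact_mod_cast hD
  have hγ : 0 < 4 - ((d:ℝ) + n) * α / 2 := by
    rw [lt_div_iff₀ (by linarith)] at hα'
    nlinarith
  set γ := 4 - ((d:ℝ) + n) * α / 2 with hγd
  have hr1 : (1/2 : ℝ) ^ γ < 1 := Real.rpow_lt_one (by norm_num) (by norm_num) hγ
  have hr2 : 0 < (1 - (1/2 : ℝ) ^ γ)⁻¹ := inv_pos.2 (by linarith)
  set C1 : ℝ := (24 * c * 2 ^ (d + n)) ^ (α / 2) * 8 * ((d:ℝ) + n) ^ 2 *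
    (1 - (1/2 : ℝ) ^ γ)⁻¹ with hC1
  have hC10 : 0 < C1 := by positivity
  set ε : ℝ := (α + 2) / 4 with hε
  have hε0 : 0 < ε := by positivity
  set h₀ : ℝ := min (2 * π) ((ε / C1) ^ (1 / γ)) with hh
  have hh0 : 0 < h₀ := lt_min (by positivity) (by positivity)
  have hh1 : h₀ ≤ 2 * π := min_le_left _ _
  have hh2 : C1 * h₀ ^ γ ≤ ε := by
    have : h₀ ^ γ ≤ ε / C1 := by
      calc h₀ ^ γ ≤ ((ε / C1) ^ (1 / γ)) ^ γ :=
            Real.rpow_le_rpow hh0.le (min_le_right _ _) hγ.le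
        _ = ε / C1 := by
            rw [← Real.rpow_mul (by positivity), one_div, inv_mul_cancel₀ hγ.ne', Real.rpow_one]
    rw [le_div_iff₀ hC10] at this
    linarith
  set C0 : ℝ := (24 * c / h₀ ^ (d + n)) ^ (α / 2) * c with hC0
  refine ⟨-(|β| * (|β| + 1) * c / 4 + C0 / (α + 2)), ?_⟩
  rintro _ ⟨u, ⟨hu, hm⟩, rfl⟩
  have hg := hu.good
  have hN := Npow_bound hg hD α h₀ hα hγ (by rw [hm]; exact hc) hh0 hh1
  rw [hm] at hN
  have hL0 : 0 ≤ lapSq d n u := integral_nonneg fun z => by positivity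
  have hN2 : Npow d n (α + 2) u ≤ C0 + ε * lapSq d n u := by
    refine hN.trans ?_
    have := mul_le_mul_of_nonneg_right hh2 hL0
    linarith
  have hQ := grad_bound hg (1 / (|β| + 1)) (by positivity)
  rw [← gradSq_eq hg, hm] at hQ
  have hQ0 : 0 ≤ gradSq d n u := by
    rw [gradSq_eq hg]
    exact integral_nonneg fun z => Finset.sum_nonneg fun i _ => by positivity
  have hb : |β| * gradSq d n u ≤ |β| * (|β| + 1) * c / 2 + lapSq d n u / 2 := by
    have h1 := mul_le_mul_of_nonneg_left hQ (abs_nonneg β)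
    have h2 : |β| * (1 / (2 * (1 / (|β| + 1))) * c + 1 / (|β| + 1) / 2 * lapSq d n u) =
      |β| * (|β| + 1) * c / 2 + (|β| / (|β| + 1)) * lapSq d n u / 2 := by
      field_simp
    have h3 : |β| / (|β| + 1) ≤ 1 := by
      rw [div_le_one (by positivity)]; linarith
    have h4 := mul_le_mul_of_nonneg_right h3 hL0
    linarith
  have hb2 : -(|β| * gradSq d n u) ≤ β * gradSq d n u := by
    have := mul_le_mul_of_nonneg_right (neg_abs_le β) hQ0
    linarith
  have hN3 : 1 / (α + 2) * Npow d n (α + 2) u ≤ C0 / (α + 2) + lapSq d n u / 4 := by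
    have h1 := mul_le_mul_of_nonneg_left hN2 (by positivity : 0 ≤ 1 / (α + 2))
    have h2 : 1 / (α + 2) * (C0 + ε * lapSq d n u) = C0 / (α + 2) + lapSq d n u / 4 := by
      rw [hε]; field_simp
    linarith
  unfold En
  linarith

/-! ### Scaling -/

lemma dX_smul {d n : ℕ} (i) (r : ℝ) (u : Pt d n → ℂ) :
    dX d n i (fun z => r • u z) = fun z => r • dX d n i u z := by
  funext z
  have := congrArg (fun L : Pt d n → (Pt d n →L[ℝ] ℂ) => L z (Pi.single i 1, 0))
    (fderiv_const_smul_field (𝕜 := ℝ) (f := u) r)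
  exact this

lemma dY_smul {d n : ℕ} (i) (r : ℝ) (u : Pt d n → ℂ) :
    dY d n i (fun z => r • u z) = fun z => r • dY d n i u z := by
  funext z
  have := congrArg (fun L : Pt d n → (Pt d n →L[ℝ] ℂ) => L z (0, Pi.single i 1))
    (fderiv_const_smul_field (𝕜 := ℝ) (f := u) r)
  exact this

lemma nsq (r : ℝ) (a : ℂ) : ‖r • a‖ ^ 2 = r ^ 2 * ‖a‖ ^ 2 := by
  rw [norm_smul, mul_pow, Real.norm_eq_abs, sq_abs]

lemma Mass_smul {d n : ℕ} (r : ℝ) (u : Pt d n → ℂ) :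
    Mass d n (fun z => r • u z) = r ^ 2 * Mass d n u := by
  simp only [Mass, nsq, integral_const_mul]

lemma lapSq_smul {d n : ℕ} (r : ℝ) (u : Pt d n → ℂ) :
    lapSq d n (fun z => r • u z) = r ^ 2 * lapSq d n u := by
  simp only [lapSq, lap, lapX, lapY, dX_smul, dY_smul, ← Finset.smul_sum, ← smul_add, nsq,
    integral_const_mul]

lemma gradSq_smul {d n : ℕ} (r : ℝ) (u : Pt d n → ℂ) :
    gradSq d n (fun z => r • u z) = r ^ 2 * gradSq d n u := by
  simp only [gradSq, gradXSq, gradYSq, dX_smul, dY_smul, nsq, ← Finset.mul_sum,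
    integral_const_mul, mul_add]

lemma Npow_smul {d n : ℕ} (p r : ℝ) (hr : 0 ≤ r) (u : Pt d n → ℂ) :
    Npow d n p (fun z => r • u z) = r ^ p * Npow d n p u := by
  simp only [Npow, norm_smul, Real.norm_eq_abs, abs_of_nonneg hr,
    Real.mul_rpow hr (norm_nonneg _), integral_const_mul]

lemma InH2_smul {d n : ℕ} (r : ℝ) {u : Pt d n → ℂ} (h : InH2 d n u) :
    InH2 d n (fun z => r • u z) := by
  obtain ⟨h1, h2, h3, h4, h5⟩ := h
  refine ⟨h1.const_smul r, fun j p => by simp only [h2 j p], ?_, ?_, ?_⟩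
  · simpa only [nsq] using h3.const_mul (r ^ 2)
  · simpa only [dX_smul, dY_smul, nsq, ← Finset.mul_sum, ← mul_add] using h4.const_mul (r ^ 2)
  · have : hessInt d n (fun z => r • u z) = fun z => r ^ 2 * hessInt d n u z := by
      funext z
      simp only [hessInt, dX_smul, dY_smul, nsq, ← Finset.mul_sum, ← mul_add]
    rw [this]
    exact h5.const_mul _

end BNLS

open BNLS in
/-- strict sub-homogeneity `m_{c₂} < (c₂/c₁) m_{c₁}`. -/
theorem stmt_6 (d n : ℕ) (hd : 1 ≤ d) (hn : 1 ≤ n) (β α c₁ c₂ : ℝ)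
    (hα : 0 < α) (hα' : α < 8 / ((d:ℝ)+n)) (hc₁ : 0 < c₁) (hc : c₁ < c₂)
    (hneg : mC d n β α c₁ < 0)
    (hseq : ∃ u : ℕ → Pt d n → ℂ, (∀ k, u k ∈ Sset d n c₁) ∧
      Tendsto (fun k => En d n β α (u k)) atTop (nhds (mC d n β α c₁)) ∧
      0 < Filter.liminf (fun k => LpN d n (α+2) (u k)) atTop) :
    mC d n β α c₂ < (c₂ / c₁) * mC d n β α c₁ := by
  obtain ⟨u, huS, huE, hlim⟩ := hseq
  have hbdd := En_bdd d n (by omega) β α c₂ hα hα' (hc₁.trans hc)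
  obtain ⟨a, ha0, ha⟩ : ∃ a : ℝ, 0 < a ∧ ∀ᶠ k in atTop, a ≤ LpN d n (α+2) (u k) := by
    rw [Filter.liminf_eq] at hlim
    have hne : {a : ℝ | ∀ᶠ k in atTop, a ≤ LpN d n (α+2) (u k)}.Nonempty := by
      by_contra h
      rw [Set.not_nonempty_iff_eq_empty] at h
      rw [h, Real.sSup_empty] at hlim
      exact lt_irrefl _ hlim
    obtain ⟨a, ha, ha0⟩ := exists_lt_of_lt_csSup hne hlim
    exact ⟨a, ha0, ha⟩
  set t : ℝ := c₂ / c₁ with ht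
  have ht1 : 1 < t := by rw [ht, lt_div_iff₀ hc₁]; linarith
  have ht0 : 0 < t := by linarith
  have htα : 1 < t ^ (α / 2) := Real.one_lt_rpow ht1 (by positivity)
  set κ : ℝ := t * (t ^ (α / 2) - 1) * (1 / (α + 2)) * a ^ (α + 2) with hκ
  have hκ0 : 0 < κ := by
    have : 0 < t ^ (α / 2) - 1 := by linarith
    positivity
  have hEn : ∀ k, En d n β α (fun z => √t • u k z) =
      t * En d n β α (u k) -
        t * (t ^ (α / 2) - 1) * (1 / (α + 2)) * Npow d n (α + 2) (u k) := by
    intro k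
    have hp : √t ^ (α + 2) = t * t ^ (α / 2) := by
      rw [Real.sqrt_eq_rpow, ← Real.rpow_mul ht0.le]
      nth_rewrite 2 [← Real.rpow_one t]
      rw [← Real.rpow_add ht0]
      congr 1; ring
    unfold En
    rw [lapSq_smul, gradSq_smul, Npow_smul _ _ (Real.sqrt_nonneg t), Real.sq_sqrt ht0.le, hp]
    ring
  have hmem : ∀ k, (fun z => √t • u k z) ∈ Sset d n c₂ := by
    intro k
    refine ⟨InH2_smul _ (huS k).1, ?_⟩
    rw [Mass_smul, Real.sq_sqrt ht0.le, (huS k).2, ht]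
    field_simp
  have hle : ∀ᶠ k in atTop, mC d n β α c₂ ≤ t * En d n β α (u k) - κ := by
    filter_upwards [ha] with k hk
    have h1 : mC d n β α c₂ ≤ En d n β α (fun z => √t • u k z) :=
      csInf_le hbdd ⟨_, hmem k, rfl⟩
    have hN0 : 0 ≤ Npow d n (α + 2) (u k) := integral_nonneg fun z => by positivity
    have h2 : a ^ (α + 2) ≤ Npow d n (α + 2) (u k) := by
      have := Real.rpow_le_rpow ha0.le hk (by linarith : 0 ≤ α + 2)
      unfold LpN at this
      rwa [← Real.rpow_mul hN0, one_div, inv_mul_cancel₀ (by linarith), Real.rpow_one] at this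
    have h3 : κ ≤ t * (t ^ (α / 2) - 1) * (1 / (α + 2)) * Npow d n (α + 2) (u k) := by
      rw [hκ]
      have : 0 < t ^ (α / 2) - 1 := by linarith
      gcongr
    rw [hEn k] at h1
    linarith
  have hfin : mC d n β α c₂ ≤ t * mC d n β α c₁ - κ :=
    ge_of_tendsto ((huE.const_mul t).sub_const κ) hle
  linarith
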